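/- arXiv:2301.09222 — 7 statements merged into one kernel-verified Lean document; each statement's English description precedes it below -/
import Mathlib

section
/- Let n ≥ 2 be an integer, δ > 0 a real number, and λ₁, …, λₙ real numbers with λᵢ²λⱼ² < 1 for all i ≠ j. If φ(λ₁,…,λₙ) ≥ −δ, then λᵢ² ≤ e^δ − 1 for every i ∈ {1,…,n}. -/
open Finset Real

theorem singular_value_bound_from_phi
    (n : ℕ) (hn : 2 ≤ n) (δ : ℝ) (hδ : 0 < δ) (l : Fin n → ℝ)
    (hpair : ∀ i j : Fin n, i ≠ j → (l i) ^ 2 * (l j) ^ 2 < 1)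
    (hφ : Real.log (∏ p ∈ Finset.univ.filter (fun p : Fin n × Fin n => p.1 < p.2),
        (1 - (l p.1) ^ 2 * (l p.2) ^ 2) / ((1 + (l p.1) ^ 2) * (1 + (l p.2) ^ 2))) ≥ -δ) :
    ∀ i : Fin n, (l i) ^ 2 ≤ Real.exp δ - 1 := by
  intro i
  set f : Fin n × Fin n → ℝ := fun p =>
    (1 - (l p.1) ^ 2 * (l p.2) ^ 2) / ((1 + (l p.1) ^ 2) * (1 + (l p.2) ^ 2)) with hf
  set S := Finset.univ.filter (fun p : Fin n × Fin n => p.1 < p.2) with hS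
  have hpos : ∀ p ∈ S, 0 < f p := fun p hp => by
    have := hpair p.1 p.2 (Finset.mem_filter.mp hp).2.ne
    exact div_pos (by linarith) (by positivity)
  have hle : ∀ p ∈ S, f p ≤ 1 := fun p _ => by
    refine (div_le_one (by positivity)).mpr ?_
    nlinarith [sq_nonneg (l p.1), sq_nonneg (l p.2),
      mul_nonneg (sq_nonneg (l p.1)) (sq_nonneg (l p.2))]
  have hbound : ∃ p ∈ S, f p ≤ 1 / (1 + (l i) ^ 2) := by
    have : Nontrivial (Fin n) := Fin.nontrivial_iff_two_le.mpr hn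
    obtain ⟨j, hj⟩ := exists_ne i
    have key : (1 - (l i) ^ 2 * (l j) ^ 2) / ((1 + (l i) ^ 2) * (1 + (l j) ^ 2))
        ≤ 1 / (1 + (l i) ^ 2) := by
      rw [← div_div, div_right_comm]
      gcongr
      refine (div_le_one (by positivity)).mpr ?_
      nlinarith [sq_nonneg (l j), mul_nonneg (sq_nonneg (l i)) (sq_nonneg (l j))]
    rcases hj.lt_or_gt with h | h
    · refine ⟨(j, i), by simpa [hS] using h, ?_⟩
      simpa only [hf, mul_comm] using key
    · exact ⟨(i, j), by simpa [hS] using h, key⟩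
  obtain ⟨p, hp, hpi⟩ := hbound
  have hprod : ∏ q ∈ S, f q ≤ f p := by
    rw [← Finset.mul_prod_erase S f hp]
    exact mul_le_of_le_one_right (hpos p hp).le
      (Finset.prod_le_one (fun q hq => (hpos q (Finset.mem_of_mem_erase hq)).le)
        fun q hq => hle q (Finset.mem_of_mem_erase hq))
  have hexp : Real.exp (-δ) ≤ 1 / (1 + (l i) ^ 2) :=
    ((Real.le_log_iff_exp_le (Finset.prod_pos hpos)).mp hφ).trans (hprod.trans hpi)
  rw [Real.exp_neg, ← one_div] at hexp
  linarith [(one_div_le_one_div (Real.exp_pos δ) (by positivity)).mp hexp]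
end

section
/- Let n ≥ 2 be an integer, δ > 0 a real number, and λ₁, …, λₙ real numbers with λᵢ²λⱼ² < 1 for all i ≠ j. If φ(λ₁,…,λₙ) ≥ −δ, then λᵢ²λⱼ² ≤ (e^δ − 1)/(e^δ + 1) for all i ≠ j. -/
open Finset Real

theorem product_singular_value_bound_from_phi
    (n : ℕ) (hn : 2 ≤ n) (δ : ℝ) (hδ : 0 < δ) (l : Fin n → ℝ)
    (hpair : ∀ i j : Fin n, i ≠ j → (l i) ^ 2 * (l j) ^ 2 < 1)
    (hφ : Real.log (∏ p ∈ Finset.univ.filter (fun p : Fin n × Fin n => p.1 < p.2),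
        (1 - (l p.1) ^ 2 * (l p.2) ^ 2) / ((1 + (l p.1) ^ 2) * (1 + (l p.2) ^ 2))) ≥ -δ) :
    ∀ i j : Fin n, i ≠ j →
      (l i) ^ 2 * (l j) ^ 2 ≤ (Real.exp δ - 1) / (Real.exp δ + 1) := by
  set f : Fin n × Fin n → ℝ := fun p =>
    (1 - (l p.1) ^ 2 * (l p.2) ^ 2) / ((1 + (l p.1) ^ 2) * (1 + (l p.2) ^ 2)) with hf
  have hpos : ∀ p ∈ Finset.univ.filter (fun p : Fin n × Fin n => p.1 < p.2), 0 < f p := by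
    intro p hp
    have h := hpair p.1 p.2 (Finset.mem_filter.mp hp).2.ne
    exact div_pos (by linarith) (by positivity)
  have hle : ∀ p : Fin n × Fin n, f p ≤ 1 := by
    intro p
    refine div_le_one_of_le₀ ?_ (by positivity)
    nlinarith [sq_nonneg (l p.1), sq_nonneg (l p.2),
      mul_nonneg (sq_nonneg (l p.1)) (sq_nonneg (l p.2))]
  have hprod := (Real.le_log_iff_exp_le (Finset.prod_pos hpos)).mp hφ
  have key : ∀ i j : Fin n, i < j →
      (l i) ^ 2 * (l j) ^ 2 ≤ (Real.exp δ - 1) / (Real.exp δ + 1) := by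
    intro i j hij
    have hmem : (i, j) ∈ Finset.univ.filter (fun p : Fin n × Fin n => p.1 < p.2) := by
      simpa using hij
    have hfactor : Real.exp (-δ) ≤ f (i, j) := by
      refine hprod.trans ?_
      rw [← Finset.mul_prod_erase _ _ hmem]
      exact mul_le_of_le_one_right (hpos _ hmem).le
        (Finset.prod_le_one (fun p hp => (hpos p (Finset.mem_of_mem_erase hp)).le)
          fun p _ => hle p)
    have hi := sq_nonneg (l i)
    have hj := sq_nonneg (l j)
    rw [Real.exp_neg, hf, le_div_iff₀ (by positivity), inv_mul_le_iff₀ (Real.exp_pos δ)]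
      at hfactor
    rw [le_div_iff₀ (by positivity)]
    dsimp only at hfactor
    nlinarith
  intro i j hij
  rcases hij.lt_or_gt with h | h
  · exact key i j h
  · rw [mul_comm]
    exact key j i h
end

section
/- Let n ≥ 2 be an integer, δ > 0 a real number, and λ₁, …, λₙ real numbers with λᵢ²λⱼ² < 1 for all i ≠ j. If φ(λ₁,…,λₙ) ≥ −δ, then λᵢ² + λⱼ² ≤ e^δ − 1 for all i ≠ j. -/
open Finset Real

theorem sum_singular_value_bound_from_phi
    (n : ℕ) (hn : 2 ≤ n) (δ : ℝ) (hδ : 0 < δ) (l : Fin n → ℝ)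
    (hpair : ∀ i j : Fin n, i ≠ j → (l i) ^ 2 * (l j) ^ 2 < 1)
    (hφ : Real.log (∏ p ∈ Finset.univ.filter (fun p : Fin n × Fin n => p.1 < p.2),
        (1 - (l p.1) ^ 2 * (l p.2) ^ 2) / ((1 + (l p.1) ^ 2) * (1 + (l p.2) ^ 2))) ≥ -δ) :
    ∀ i j : Fin n, i ≠ j → (l i) ^ 2 + (l j) ^ 2 ≤ Real.exp δ - 1 := by
  set s := Finset.univ.filter (fun p : Fin n × Fin n => p.1 < p.2) with hs
  set f : Fin n × Fin n → ℝ := fun p =>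
    (1 - (l p.1) ^ 2 * (l p.2) ^ 2) / ((1 + (l p.1) ^ 2) * (1 + (l p.2) ^ 2)) with hf
  have hpos : ∀ p ∈ s, 0 < f p := by
    intro p hp
    have h := hpair p.1 p.2 (Finset.mem_filter.mp hp).2.ne
    exact div_pos (by linarith) (by positivity)
  have hle : ∀ p, f p ≤ 1 := by
    intro p
    refine (div_le_one (by positivity)).mpr ?_
    nlinarith [sq_nonneg (l p.1), sq_nonneg (l p.2),
      mul_nonneg (sq_nonneg (l p.1)) (sq_nonneg (l p.2))]
  have hexp : Real.exp (-δ) ≤ ∏ p ∈ s, f p :=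
    (Real.le_log_iff_exp_le (Finset.prod_pos hpos)).mp hφ
  have hlt : ∀ i j : Fin n, i < j → (l i) ^ 2 + (l j) ^ 2 ≤ Real.exp δ - 1 := by
    intro i j hij
    have hmem : (i, j) ∈ s := by simp [hs, hij]
    have hprod : ∏ p ∈ s, f p ≤ f (i, j) := by
      rw [← Finset.mul_prod_erase s f hmem]
      exact mul_le_of_le_one_right (hpos _ hmem).le
        (Finset.prod_le_one (fun p hp => (hpos p (Finset.mem_of_mem_erase hp)).le)
          fun p _ => hle p)
    have hfac := hexp.trans hprod
    simp only [hf] at hfac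
    rw [le_div_iff₀ (by positivity), Real.exp_neg, inv_mul_le_iff₀ (Real.exp_pos δ)] at hfac
    have hij_nonneg : 0 ≤ (l i) ^ 2 * (l j) ^ 2 := by positivity
    nlinarith [mul_nonneg (Real.exp_pos δ).le hij_nonneg]
  intro i j hij
  rcases lt_or_gt_of_ne hij with h | h
  · exact hlt i j h
  · linarith [hlt j i h]
end

section
/- For every integer n ≥ 2 and every real δ > 0 there exists a constant c₁ = c₁(n,δ) > 0 such that for all real numbers λ₁, …, λₙ with λᵢ²λⱼ² < 1 for all i ≠ j and φ(λ₁,…,λₙ) ≥ −δ, one has |φ(λ₁,…,λₙ)| ≤ c₁ ∑_{i=1}^{n} λᵢ². -/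
open Finset Real

lemma factor_bounds {a b : ℝ} (ha : 0 ≤ a) (hb : 0 ≤ b) (hab : a * b < 1) :
    0 < (1 - a * b) / ((1 + a) * (1 + b)) ∧ (1 - a * b) / ((1 + a) * (1 + b)) ≤ 1 ∧
      1 - (1 - a * b) / ((1 + a) * (1 + b)) ≤ 2 * (a + b) := by
  have hmul := mul_nonneg ha hb
  have hden : 0 < (1 + a) * (1 + b) := by positivity
  refine ⟨div_pos (by linarith) hden, (div_le_one hden).2 (by nlinarith), ?_⟩
  rw [sub_le_comm, le_div_iff₀ hden]
  have h : 0 ≤ a ^ 2 * b := by positivity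
  have h' : 0 ≤ a * b ^ 2 := by positivity
  nlinarith [sq_nonneg a, sq_nonneg b]

lemma neg_log_le_exp_mul_one_sub {x δ : ℝ} (hx : 0 < x) (hx1 : x ≤ 1) (h : -Real.log x ≤ δ) :
    -Real.log x ≤ Real.exp δ * (1 - x) := by
  have hinv : x⁻¹ ≤ Real.exp δ := by
    rw [← Real.exp_log (inv_pos.2 hx), Real.log_inv]
    exact Real.exp_le_exp.2 h
  calc -Real.log x ≤ x⁻¹ - 1 := by linarith [Real.one_sub_inv_le_log_of_pos hx]
    _ = x⁻¹ * (1 - x) := by field_simp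
    _ ≤ Real.exp δ * (1 - x) := mul_le_mul_of_nonneg_right hinv (by linarith)

/-- If every factor lies in `(0, 1]` and is within `t` of `1`, and the logarithm of the product
is at least `-δ`, then that logarithm is bounded linearly in `t`. -/
lemma abs_log_prod_le {ι : Type*} (s : Finset ι) (f : ι → ℝ) {δ t : ℝ}
    (hpos : ∀ p ∈ s, 0 < f p) (hle : ∀ p ∈ s, f p ≤ 1) (ht : ∀ p ∈ s, 1 - f p ≤ t)
    (h : -δ ≤ Real.log (∏ p ∈ s, f p)) :
    |Real.log (∏ p ∈ s, f p)| ≤ s.card * (Real.exp δ * t) := by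
  rw [Real.log_prod (fun p hp => (hpos p hp).ne')] at h ⊢
  have hnn : ∀ p ∈ s, 0 ≤ -Real.log (f p) := fun p hp =>
    neg_nonneg.2 (Real.log_nonpos (hpos p hp).le (hle p hp))
  rw [← abs_neg, ← Finset.sum_neg_distrib, abs_of_nonneg (Finset.sum_nonneg hnn), ← nsmul_eq_mul]
  refine Finset.sum_le_card_nsmul _ _ _ fun p hp => ?_
  have hδ : -Real.log (f p) ≤ δ := by
    have hsingle := Finset.single_le_sum hnn hp
    rw [Finset.sum_neg_distrib] at hsingle
    linarith
  exact (neg_log_le_exp_mul_one_sub (hpos p hp) (hle p hp) hδ).trans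
    (mul_le_mul_of_nonneg_left (ht p hp) (Real.exp_pos δ).le)

theorem abs_phi_le_const_mul_sum_sq
    (n : ℕ) (hn : 2 ≤ n) (δ : ℝ) (hδ : 0 < δ) :
    ∃ c₁ : ℝ, 0 < c₁ ∧
      ∀ l : Fin n → ℝ,
        (∀ i j : Fin n, i ≠ j → (l i) ^ 2 * (l j) ^ 2 < 1) →
        Real.log (∏ p ∈ Finset.univ.filter (fun p : Fin n × Fin n => p.1 < p.2),
          (1 - (l p.1) ^ 2 * (l p.2) ^ 2) / ((1 + (l p.1) ^ 2) * (1 + (l p.2) ^ 2))) ≥ -δ →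
        |Real.log (∏ p ∈ Finset.univ.filter (fun p : Fin n × Fin n => p.1 < p.2),
          (1 - (l p.1) ^ 2 * (l p.2) ^ 2) / ((1 + (l p.1) ^ 2) * (1 + (l p.2) ^ 2)))|
          ≤ c₁ * ∑ i : Fin n, (l i) ^ 2 := by
  set s := Finset.univ.filter (fun p : Fin n × Fin n => p.1 < p.2) with hs
  refine ⟨(s.card + 1) * (Real.exp δ * 4), by positivity, fun l hl hφ => ?_⟩
  have hS : ∀ i, (l i) ^ 2 ≤ ∑ i : Fin n, (l i) ^ 2 := fun i =>
    Finset.single_le_sum (f := fun i => (l i) ^ 2) (fun i _ => sq_nonneg (l i)) (Finset.mem_univ i)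
  have hbd := fun p (hp : p ∈ s) => factor_bounds (sq_nonneg (l p.1)) (sq_nonneg (l p.2))
    (hl p.1 p.2 (Finset.mem_filter.1 hp).2.ne)
  have hS0 : 0 ≤ ∑ i : Fin n, (l i) ^ 2 := Finset.sum_nonneg fun i _ => sq_nonneg (l i)
  have key := abs_log_prod_le s _ (t := 4 * ∑ i : Fin n, (l i) ^ 2) (fun p hp => (hbd p hp).1)
    (fun p hp => (hbd p hp).2.1)
    (fun p hp => (hbd p hp).2.2.trans (by linarith [hS p.1, hS p.2])) hφ
  refine key.trans ?_
  have : 0 ≤ Real.exp δ * (4 * ∑ i : Fin n, (l i) ^ 2) := by positivity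
  linarith
end

section
/- Let n ≥ 2 and m ≥ 1 be integers and fix i ≠ j in {1,…,n}. Let λ₁, …, λ_{max(n,m)} be nonnegative reals with λ_p = 0 for p > min(n,m) and λ_p λ_q < 1 for all p ≠ q; set S_p = (1−λ_p²)/(1+λ_p²) and C_p = 2λ_p/(1+λ_p²). Let h_{ℓ,k,a} be real numbers for ℓ ∈ {1,…,m}, k ∈ {1,…,n}, a ∈ {i,j}, with the convention that any term h_{ℓ,k,a} with ℓ > m is taken to be 0. Define I = ∑_{k=1}^{n} ∑_{ℓ=1}^{m} [ h_{ℓ,k,i}² (S_i + S_ℓ) + h_{ℓ,k,j}² (S_j + S_ℓ) ] and II = (S_i+S_j)⁻¹ ∑_{k=1}^{n} ( h_{i,k,i} C_i + h_{j,k,j} C_j )². Then I + II ≥ (S_i+S_j) ∑_{k=1}^{n} [ h_{j,k,i}² + h_{i,k,j}² + h_{i,k,i}² + h_{j,k,j}² + ∑_{ℓ=n+1}^{m} ( h_{ℓ,k,i}² + h_{ℓ,k,j}² ) ] + (S_i+S_j)⁻¹ ∑_{k=1}^{n} ( h_{i,k,i} C_j + h_{j,k,j} C_i )². -/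
open Finset

/-- `S λ = (1 - λ²)/(1 + λ²)`. -/
noncomputable def Sfun (l : ℕ → ℝ) (p : ℕ) : ℝ := (1 - l p ^ 2) / (1 + l p ^ 2)

/-- `C λ = 2λ/(1 + λ²)`. -/
noncomputable def Cfun (l : ℕ → ℝ) (p : ℕ) : ℝ := 2 * l p / (1 + l p ^ 2)

theorem Sfun_add_pos {l : ℕ → ℝ} {p q : ℕ} (hp : 0 ≤ l p) (hq : 0 ≤ l q)
    (hpq : l p * l q < 1) : 0 < Sfun l p + Sfun l q := by
  have key : Sfun l p + Sfun l q
      = 2 * (1 - (l p * l q) ^ 2) / ((1 + l p ^ 2) * (1 + l q ^ 2)) := by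
    unfold Sfun
    field_simp
    ring
  have h2 : (l p * l q) ^ 2 < 1 := by nlinarith [mul_nonneg hp hq]
  rw [key]
  exact div_pos (by linarith) (by positivity)

theorem Sfun_le_one (l : ℕ → ℝ) (p : ℕ) : Sfun l p ≤ 1 := by
  unfold Sfun
  rw [div_le_one (by positivity)]
  nlinarith [sq_nonneg (l p)]

theorem Sfun_sq_add_Cfun_sq (l : ℕ → ℝ) (p : ℕ) : Sfun l p ^ 2 + Cfun l p ^ 2 = 1 := by
  unfold Sfun Cfun
  field_simp
  ring

/-- The diagonal terms balance exactly. -/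
theorem diagonal_terms_eq {l : ℕ → ℝ} {i j : ℕ} (hpos : 0 < Sfun l i + Sfun l j) (x y : ℝ) :
    2 * Sfun l i * x ^ 2 + 2 * Sfun l j * y ^ 2
        + (Sfun l i + Sfun l j)⁻¹ * (x * Cfun l i + y * Cfun l j) ^ 2
      = (Sfun l i + Sfun l j) * (x ^ 2 + y ^ 2)
        + (Sfun l i + Sfun l j)⁻¹ * (x * Cfun l j + y * Cfun l i) ^ 2 := by
  have hi := Sfun_sq_add_Cfun_sq l i
  have hj := Sfun_sq_add_Cfun_sq l j
  field_simp
  linear_combination (x ^ 2 - y ^ 2) * (hi - hj)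

theorem key_algebraic_inequality_I_plus_II
    (n m : ℕ) (hn : 2 ≤ n) (hm : 1 ≤ m)
    (i j : ℕ) (hi : i ∈ Finset.Icc 1 n) (hj : j ∈ Finset.Icc 1 n) (hij : i ≠ j)
    (l : ℕ → ℝ)
    (hl0 : ∀ p ∈ Finset.Icc 1 (max n m), 0 ≤ l p)
    (hlz : ∀ p ∈ Finset.Icc 1 (max n m), min n m < p → l p = 0)
    (hpair : ∀ p ∈ Finset.Icc 1 (max n m), ∀ q ∈ Finset.Icc 1 (max n m),
      p ≠ q → l p * l q < 1)
    (h : ℕ → ℕ → ℕ → ℝ)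
    (hconv : ∀ ℓ k a, m < ℓ → h ℓ k a = 0) :
    (∑ k ∈ Finset.Icc 1 n, ∑ ℓ ∈ Finset.Icc 1 m,
        (h ℓ k i ^ 2 * (Sfun l i + Sfun l ℓ) + h ℓ k j ^ 2 * (Sfun l j + Sfun l ℓ)))
      + (Sfun l i + Sfun l j)⁻¹
          * ∑ k ∈ Finset.Icc 1 n, (h i k i * Cfun l i + h j k j * Cfun l j) ^ 2
    ≥ (Sfun l i + Sfun l j)
        * ∑ k ∈ Finset.Icc 1 n,
            (h j k i ^ 2 + h i k j ^ 2 + h i k i ^ 2 + h j k j ^ 2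
              + ∑ ℓ ∈ Finset.Icc (n + 1) m, (h ℓ k i ^ 2 + h ℓ k j ^ 2))
      + (Sfun l i + Sfun l j)⁻¹
          * ∑ k ∈ Finset.Icc 1 n, (h i k i * Cfun l j + h j k j * Cfun l i) ^ 2 := by
  have hN : ∀ {p}, p ∈ Finset.Icc 1 n → p ∈ Finset.Icc 1 (max n m) := fun hp =>
    Finset.Icc_subset_Icc le_rfl (le_max_left n m) hp
  have hS : ∀ p ∈ Finset.Icc 1 (max n m), ∀ q ∈ Finset.Icc 1 (max n m), p ≠ q →
      0 < Sfun l p + Sfun l q := fun p hp q hq hpq =>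
    Sfun_add_pos (hl0 p hp) (hl0 q hq) (hpair p hp q hq hpq)
  have hpos := hS i (hN hi) j (hN hj) hij
  rw [ge_iff_le, Finset.mul_sum, Finset.mul_sum, Finset.mul_sum, ← Finset.sum_add_distrib,
    ← Finset.sum_add_distrib]
  refine Finset.sum_le_sum fun k _ => ?_
  set F : ℕ → ℝ := fun ℓ =>
    h ℓ k i ^ 2 * (Sfun l i + Sfun l ℓ) + h ℓ k j ^ 2 * (Sfun l j + Sfun l ℓ) with hF
  have hext : ∑ ℓ ∈ Finset.Icc 1 m, F ℓ = ∑ ℓ ∈ Finset.Icc 1 (max n m), F ℓ := by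
    refine Finset.sum_subset (Finset.Icc_subset_Icc le_rfl (le_max_right n m)) ?_
    intro ℓ hℓ hℓm
    have : m < ℓ := by simp only [Finset.mem_Icc] at hℓ hℓm; omega
    simp [hF, hconv ℓ _ _ this]
  have hsub : {i, j} ∪ Finset.Icc (n + 1) m ⊆ Finset.Icc 1 (max n m) := by
    intro ℓ hℓ
    simp only [Finset.mem_union, Finset.mem_insert, Finset.mem_singleton, Finset.mem_Icc]
      at hℓ hi hj ⊢
    omega
  have hdisj : Disjoint ({i, j} : Finset ℕ) (Finset.Icc (n + 1) m) := by
    rw [Finset.disjoint_left]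
    intro ℓ hℓ
    simp only [Finset.mem_insert, Finset.mem_singleton, Finset.mem_Icc] at hℓ hi hj ⊢
    omega
  have hlow : ∑ ℓ ∈ {i, j} ∪ Finset.Icc (n + 1) m, F ℓ
      ≤ ∑ ℓ ∈ Finset.Icc 1 (max n m), F ℓ := by
    refine Finset.sum_le_sum_of_subset_of_nonneg hsub fun ℓ hℓ hℓn => ?_
    simp only [Finset.mem_union, Finset.mem_insert, Finset.mem_singleton, not_or] at hℓn
    have h1 := hS i (hN hi) ℓ hℓ (Ne.symm hℓn.1.1)
    have h2 := hS j (hN hj) ℓ hℓ (Ne.symm hℓn.1.2)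
    positivity
  rw [Finset.sum_union hdisj, Finset.sum_pair hij] at hlow
  have htail : (Sfun l i + Sfun l j)
        * ∑ ℓ ∈ Finset.Icc (n + 1) m, (h ℓ k i ^ 2 + h ℓ k j ^ 2)
      ≤ ∑ ℓ ∈ Finset.Icc (n + 1) m, F ℓ := by
    rw [Finset.mul_sum]
    refine Finset.sum_le_sum fun ℓ hℓ => ?_
    rw [Finset.mem_Icc] at hℓ
    have hl : l ℓ = 0 := hlz ℓ (by rw [Finset.mem_Icc]; omega) (by omega)
    have hSℓ : Sfun l ℓ = 1 := by simp [Sfun, hl]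
    simp only [hF, hSℓ]
    nlinarith [mul_nonneg (sq_nonneg (h ℓ k i)) (sub_nonneg.2 (Sfun_le_one l j)),
      mul_nonneg (sq_nonneg (h ℓ k j)) (sub_nonneg.2 (Sfun_le_one l i))]
  have hdiag := diagonal_terms_eq hpos (h i k i) (h j k j)
  have hFij : F i + F j = 2 * Sfun l i * h i k i ^ 2 + 2 * Sfun l j * h j k j ^ 2
      + (Sfun l i + Sfun l j) * (h j k i ^ 2 + h i k j ^ 2) := by
    simp only [hF]
    ring
  rw [hext]
  linarith
end

section
/- For every integer n ≥ 2 there exists a constant c₂ = c₂(n) > 0 with the following property: for every δ > 0, all real numbers λ₁, …, λₙ with λᵢ²λⱼ² < 1 for all i ≠ j and φ(λ₁,…,λₙ) ≥ −δ, and all real numbers a₁, …, aₙ, one has ( 2 ∑_{1≤i<j≤n} ((1+λᵢ²)(1+λⱼ²)/(1−λᵢ²λⱼ²)) ( aᵢ λᵢ/(1+λᵢ²) + aⱼ λⱼ/(1+λⱼ²) ) )² ≤ c₂ e^{4δ}(e^δ − 1) ∑_{i=1}^{n} aᵢ². -/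
open Finset Real

/-- A product of numbers in `[0, 1]` is at most each of its factors. -/
lemma prod_le_factor_of_le_one {ι : Type*} {s : Finset ι} {f : ι → ℝ}
    (h0 : ∀ i ∈ s, 0 ≤ f i) (h1 : ∀ i ∈ s, f i ≤ 1) {i : ι} (hi : i ∈ s) :
    ∏ j ∈ s, f j ≤ f i := by
  classical
  rw [← Finset.mul_prod_erase s f hi]
  exact mul_le_of_le_one_right (h0 i hi) (Finset.prod_le_one
    (fun j hj => h0 j (Finset.mem_of_mem_erase hj))
    (fun j hj => h1 j (Finset.mem_of_mem_erase hj)))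

lemma div_one_add_sq_sq_le (x : ℝ) : (x / (1 + x ^ 2)) ^ 2 ≤ x ^ 2 := by
  rw [div_pow]
  exact div_le_self (sq_nonneg x) (one_le_pow₀ (by nlinarith [sq_nonneg x]))

/-- The bound on the contribution of a single pair `(x, y)` to the gradient, where `E` bounds the
inverse of the corresponding factor of `det S̃`. -/
lemma pair_gradient_sq_le {x y a b E : ℝ} (hE : 1 ≤ E) (hxy : x ^ 2 * y ^ 2 < 1)
    (h : (1 + x ^ 2) * (1 + y ^ 2) / (1 - x ^ 2 * y ^ 2) ≤ E) :
    (((1 + x ^ 2) * (1 + y ^ 2) / (1 - x ^ 2 * y ^ 2))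
      * (a * (x / (1 + x ^ 2)) + b * (y / (1 + y ^ 2)))) ^ 2
      ≤ E ^ 4 * (E - 1) * (a ^ 2 + b ^ 2) := by
  have hpos : 0 < 1 - x ^ 2 * y ^ 2 := by linarith
  have hg : 0 ≤ (1 + x ^ 2) * (1 + y ^ 2) / (1 - x ^ 2 * y ^ 2) := by positivity
  have hsum : x ^ 2 + y ^ 2 ≤ E - 1 := by
    rw [div_le_iff₀ hpos] at h
    nlinarith [mul_nonneg (sq_nonneg x) (sq_nonneg y),
      mul_nonneg (sub_nonneg.2 hE) (mul_nonneg (sq_nonneg x) (sq_nonneg y))]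
  have hcs (u v : ℝ) : (a * u + b * v) ^ 2 ≤ (u ^ 2 + v ^ 2) * (a ^ 2 + b ^ 2) := by
    nlinarith [sq_nonneg (a * v - b * u)]
  have hlin : (a * (x / (1 + x ^ 2)) + b * (y / (1 + y ^ 2))) ^ 2
      ≤ (E - 1) * (a ^ 2 + b ^ 2) := by
    refine (hcs _ _).trans (mul_le_mul_of_nonneg_right ?_ (by positivity))
    linarith [div_one_add_sq_sq_le x, div_one_add_sq_sq_le y]
  rw [mul_pow, mul_assoc]
  refine mul_le_mul ?_ hlin (sq_nonneg _) (by positivity)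
  exact (pow_le_pow_left₀ hg h 2).trans (pow_le_pow_right₀ hE (by norm_num))


theorem gradient_log_det_bound
    (n : ℕ) (hn : 2 ≤ n) :
    ∃ c₂ : ℝ, 0 < c₂ ∧
      ∀ δ : ℝ, 0 < δ →
      ∀ l : Fin n → ℝ,
        (∀ i j : Fin n, i ≠ j → (l i) ^ 2 * (l j) ^ 2 < 1) →
        Real.log (∏ p ∈ Finset.univ.filter (fun p : Fin n × Fin n => p.1 < p.2),
          (1 - (l p.1) ^ 2 * (l p.2) ^ 2) / ((1 + (l p.1) ^ 2) * (1 + (l p.2) ^ 2))) ≥ -δ →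
      ∀ a : Fin n → ℝ,
        (2 * ∑ p ∈ Finset.univ.filter (fun p : Fin n × Fin n => p.1 < p.2),
            ((1 + (l p.1) ^ 2) * (1 + (l p.2) ^ 2) / (1 - (l p.1) ^ 2 * (l p.2) ^ 2))
              * (a p.1 * (l p.1 / (1 + (l p.1) ^ 2)) + a p.2 * (l p.2 / (1 + (l p.2) ^ 2)))) ^ 2
          ≤ c₂ * Real.exp (4 * δ) * (Real.exp δ - 1) * ∑ i : Fin n, (a i) ^ 2 := by
  set s := Finset.univ.filter (fun p : Fin n × Fin n => p.1 < p.2)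
  refine ⟨4 * (#s : ℝ) ^ 2 + 1, by positivity, fun δ hδ l hl hφ a => ?_⟩
  have hE : 1 ≤ Real.exp δ := Real.one_le_exp hδ.le
  have hne : ∀ p ∈ s, p.1 ≠ p.2 := fun p hp => (Finset.mem_filter.1 hp).2.ne
  have hnum : ∀ p ∈ s, 0 < 1 - (l p.1) ^ 2 * (l p.2) ^ 2 := fun p hp =>
    sub_pos.2 (hl _ _ (hne p hp))
  have hf0 : ∀ p ∈ s,
      0 < (1 - (l p.1) ^ 2 * (l p.2) ^ 2) / ((1 + (l p.1) ^ 2) * (1 + (l p.2) ^ 2)) :=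
    fun p hp => div_pos (hnum p hp) (by positivity)
  have hf1 : ∀ p ∈ s,
      (1 - (l p.1) ^ 2 * (l p.2) ^ 2) / ((1 + (l p.1) ^ 2) * (1 + (l p.2) ^ 2)) ≤ 1 := by
    intro p _
    rw [div_le_one (by positivity)]
    nlinarith [sq_nonneg (l p.1), sq_nonneg (l p.2),
      mul_nonneg (sq_nonneg (l p.1)) (sq_nonneg (l p.2))]
  have hprod := (Real.le_log_iff_exp_le (Finset.prod_pos hf0)).1 hφ
  have hterm : ∀ p ∈ s,
      (((1 + (l p.1) ^ 2) * (1 + (l p.2) ^ 2) / (1 - (l p.1) ^ 2 * (l p.2) ^ 2))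
        * (a p.1 * (l p.1 / (1 + (l p.1) ^ 2)) + a p.2 * (l p.2 / (1 + (l p.2) ^ 2)))) ^ 2
      ≤ Real.exp δ ^ 4 * (Real.exp δ - 1) * ∑ i, a i ^ 2 := by
    intro p hp
    have hfactor := hprod.trans (prod_le_factor_of_le_one (fun q hq => (hf0 q hq).le) hf1 hp)
    have hinv := inv_anti₀ (Real.exp_pos _) hfactor
    rw [inv_div, ← Real.exp_neg, neg_neg] at hinv
    refine (pair_gradient_sq_le hE (hl _ _ (hne p hp)) hinv).trans
      (mul_le_mul_of_nonneg_left ?_ (mul_nonneg (by positivity) (sub_nonneg.2 hE)))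
    rw [← Finset.sum_pair (f := fun i => a i ^ 2) (hne p hp)]
    exact Finset.sum_le_sum_of_subset_of_nonneg (Finset.subset_univ _)
      (fun i _ _ => sq_nonneg (a i))
  have hexp : Real.exp (4 * δ) = Real.exp δ ^ 4 := by
    rw [← Real.exp_nat_mul]; norm_num
  rw [hexp]
  have hB : 0 ≤ Real.exp δ ^ 4 * (Real.exp δ - 1) * ∑ i, a i ^ 2 :=
    mul_nonneg (mul_nonneg (by positivity) (sub_nonneg.2 hE))
      (Finset.sum_nonneg fun i _ => sq_nonneg (a i))
  have hsum := Finset.sum_le_card_nsmul s _ _ hterm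
  rw [nsmul_eq_mul] at hsum
  have hcs := (sq_sum_le_card_mul_sum_sq (s := s) (f := fun p : Fin n × Fin n =>
    ((1 + (l p.1) ^ 2) * (1 + (l p.2) ^ 2) / (1 - (l p.1) ^ 2 * (l p.2) ^ 2))
      * (a p.1 * (l p.1 / (1 + (l p.1) ^ 2)) + a p.2 * (l p.2 / (1 + (l p.2) ^ 2))))).trans
    (mul_le_mul_of_nonneg_left hsum (Nat.cast_nonneg _))
  rw [mul_pow]
  linarith
end

section
/- Let λᵢ, λⱼ, λ_k be nonnegative real numbers with λᵢλⱼ < 1, λᵢλ_k < 1, and λⱼλ_k < 1. Then V := (1+λ_k²)(λᵢ² + λⱼ² − 2λᵢ²λⱼ² − 2λᵢ²λⱼ²λ_k² + λᵢ⁴λⱼ²λ_k² + λᵢ²λⱼ⁴λ_k²) / ( 2(1+λᵢ²)(1+λⱼ²)(1−λᵢ²λ_k²)(1−λⱼ²λ_k²) ) satisfies V ≥ 0. -/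
/-- Nonnegativity of the numerator in the squared variables, when `b ≤ a`. -/
lemma numerator_nonneg_of_le {a b c : ℝ} (hb : 0 ≤ b) (hc : 0 ≤ c) (hba : b ≤ a)
    (hab : a * b ≤ 1) (hac : a * c ≤ 1) :
    0 ≤ a + b - 2 * (a * b) + a * b * c * (a + b - 2) := by
  rcases le_total 2 (a + b) with h | h
  · have : 0 ≤ a * b * c * (a + b - 2) :=
      mul_nonneg (mul_nonneg (mul_nonneg (hb.trans hba) hb) hc) (sub_nonneg.2 h)
    linarith
  · have h₁ : 0 ≤ b * (1 - a * c) * (2 - (a + b)) :=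
      mul_nonneg (mul_nonneg hb (sub_nonneg.2 hac)) (sub_nonneg.2 h)
    have h₂ : 0 ≤ (a - b) * (1 - b) := mul_nonneg (sub_nonneg.2 hba) (by linarith)
    linarith

/-- Nonnegativity of the numerator in the squared variables. -/
lemma numerator_nonneg {a b c : ℝ} (ha : 0 ≤ a) (hb : 0 ≤ b) (hc : 0 ≤ c)
    (hab : a * b ≤ 1) (hac : a * c ≤ 1) (hbc : b * c ≤ 1) :
    0 ≤ a + b - 2 * (a * b) + a * b * c * (a + b - 2) := by
  rcases le_total b a with h | h
  · exact numerator_nonneg_of_le hb hc h hab hac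
  · linarith [numerator_nonneg_of_le ha hc h (by linarith) hbc]

theorem V_nonneg (li lj lk : ℝ) (hi : 0 ≤ li) (hj : 0 ≤ lj) (hk : 0 ≤ lk)
    (hij : li * lj < 1) (hik : li * lk < 1) (hjk : lj * lk < 1) :
    0 ≤ (1 + lk ^ 2)
        * (li ^ 2 + lj ^ 2 - 2 * li ^ 2 * lj ^ 2 - 2 * li ^ 2 * lj ^ 2 * lk ^ 2
            + li ^ 4 * lj ^ 2 * lk ^ 2 + li ^ 2 * lj ^ 4 * lk ^ 2)
        / (2 * (1 + li ^ 2) * (1 + lj ^ 2) * (1 - li ^ 2 * lk ^ 2) * (1 - lj ^ 2 * lk ^ 2)) := by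
  have sq_mul_sq_le_one {x y : ℝ} (hx : 0 ≤ x) (hy : 0 ≤ y) (h : x * y < 1) :
      x ^ 2 * y ^ 2 ≤ 1 := by
    rw [← mul_pow]
    exact pow_le_one₀ (mul_nonneg hx hy) h.le
  have hac := sq_mul_sq_le_one hi hk hik
  have hbc := sq_mul_sq_le_one hj hk hjk
  have hnum := numerator_nonneg (sq_nonneg li) (sq_nonneg lj) (sq_nonneg lk)
    (sq_mul_sq_le_one hi hj hij) hac hbc
  refine div_nonneg (mul_nonneg (by positivity) (by linarith)) ?_
  exact mul_nonneg (mul_nonneg (by positivity) (sub_nonneg.2 hac)) (sub_nonneg.2 hbc)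
end
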